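/- arXiv:math/0304047 — 3 statements merged into one kernel-verified Lean document; each statement's English description precedes it below -/
import Mathlib

section
/- Let q be a prime power and n ≥ 1. Then #{g ∈ GL(2n,F_q) : the characteristic polynomial of g·g^τ is squarefree} · |Sp(2n,F_q)| = #{s ∈ Sp(2n,F_q) : the characteristic polynomial of s is squarefree} · |GL(2n,F_q)|; that is, the proportion of g ∈ GL(2n,F_q) such that g·g^τ is regular semisimple equals the proportion of regular semisimple elements of Sp(2n,F_q). -/
open Matrix Polynomial

/-- The inverse-transpose automorphism of `GL(n,F)`: `g ↦ (gᵀ)⁻¹`. -/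
noncomputable def tau {n : ℕ} {F : Type} [Field F] (g : GL (Fin n) F) : GL (Fin n) F where
  val := (g⁻¹).val.transpose
  inv := g.val.transpose
  val_inv := by
    rw [← Matrix.transpose_mul, ← Units.val_mul, mul_inv_cancel, Units.val_one,
      Matrix.transpose_one]
  inv_val := by
    rw [← Matrix.transpose_mul, ← Units.val_mul, inv_mul_cancel, Units.val_one,
      Matrix.transpose_one]

theorem coe_tau {n : ℕ} {F : Type} [Field F] (g : GL (Fin n) F) :
    (tau g).val = g.valᵀ⁻¹ := by
  rw [← transpose_nonsing_inv, ← coe_units_inv]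
  rfl

theorem Polynomial.derivative_eval_one_of_reverse_eq_self {R : Type*} [CommRing R] {p : R[X]}
    {n : ℕ} (hp : p.reverse = p) (hd : p.natDegree = 2 * n) :
    p.derivative.eval 1 = n * p.eval 1 := by
  have hs : ∑ i ∈ Finset.range (2 * n + 1), p.coeff i * ((i : R) - n) = 0 := by
    refine Finset.sum_involution (fun i _ => 2 * n - i) ?_ ?_ ?_ ?_
    · intro i hi
      have hi' : i ≤ 2 * n := by grind
      have : p.coeff (2 * n - i) = p.coeff i := by
        conv_rhs => rw [← hp, coeff_reverse, hd, revAt_le hi']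
      rw [this, Nat.cast_sub hi']
      push_cast
      ring
    · intro i hi h0 hfix
      apply h0
      have : i = n := by grind
      simp [this]
    · intro i hi; grind
    · intro i hi; grind
  rw [derivative_eval, p.sum_over_range (by simp), eval_eq_sum_range, hd, Finset.mul_sum,
    ← sub_eq_zero, ← Finset.sum_sub_distrib, ← hs]
  refine Finset.sum_congr rfl fun i _ => ?_
  simp only [one_pow]
  ring

theorem Polynomial.eval_one_ne_zero_of_squarefree {F : Type*} [Field F] {p : F[X]} {n : ℕ}
    (hp : p.reverse = p) (hd : p.natDegree = 2 * n) (hsq : Squarefree p) : p.eval 1 ≠ 0 := by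
  intro h0
  have h1 := derivative_eval_one_of_reverse_eq_self hp hd
  rw [h0, mul_zero] at h1
  obtain ⟨r, hr⟩ := dvd_iff_isRoot.2 (show p.IsRoot 1 from h0)
  have h2 : r.eval 1 = 0 := by simpa [hr] using h1
  obtain ⟨t, ht⟩ := dvd_iff_isRoot.2 (show r.IsRoot 1 from h2)
  exact not_isUnit_X_sub_C (1 : F) (hsq _ ⟨t, by rw [hr, ht, mul_assoc]⟩)

namespace Matrix

variable {F ι : Type*} [Field F] [Fintype ι] [DecidableEq ι]

theorem isUnit_det_sub_one_of_squarefree_charpoly {M : Matrix ι ι F} (hdet : M.det = 1)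
    (hι : Even (Fintype.card ι)) (hM : M⁻¹.charpoly = M.charpoly) (hsq : Squarefree M.charpoly) :
    IsUnit (M - 1).det := by
  obtain ⟨n, hn⟩ := hι
  have hrev : M.charpoly.reverse = M.charpoly := by
    rw [reverse_charpoly, ← hM, charpoly_inv M (by simp [isUnit_iff_isUnit_det, hdet]), hdet, hn]
    simp
  have h := eval_one_ne_zero_of_squarefree (n := n) hrev
    (by rw [charpoly_natDegree_eq_dim, hn, two_mul]) hsq
  rw [eval_charpoly, map_one, ← neg_sub, det_neg] at h
  exact isUnit_iff_ne_zero.2 (right_ne_zero_of_mul h)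

theorem isUnit_det_sub_transpose_of_squarefree {g : Matrix ι ι F} (hg : IsUnit g.det)
    (hι : Even (Fintype.card ι)) (hsq : Squarefree (g * gᵀ⁻¹).charpoly) :
    IsUnit (g - gᵀ).det := by
  have hg' : IsUnit gᵀ.det := by rwa [det_transpose]
  have h := isUnit_det_sub_one_of_squarefree_charpoly (M := g * gᵀ⁻¹)
    (by rw [det_mul, det_nonsing_inv, det_transpose, Ring.mul_inverse_cancel _ hg]) hι
    (by rw [← charpoly_transpose (g * gᵀ⁻¹), mul_inv_rev, nonsing_inv_nonsing_inv _ hg',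
      transpose_mul, transpose_nonsing_inv, transpose_transpose, charpoly_mul_comm,
      charpoly_mul_comm]) hsq
  have e : g - gᵀ = (g * gᵀ⁻¹ - 1) * gᵀ := by
    rw [Matrix.sub_mul, nonsing_inv_mul_cancel_right _ _ hg', one_mul]
  rw [e, det_mul]
  exact h.mul hg'

end Matrix

theorem SymplecticGroup.isUnit_det_sub_one {F l : Type*} [Field F] [Fintype l] [DecidableEq l]
    {s : Matrix (l ⊕ l) (l ⊕ l) F} (hs : s ∈ symplecticGroup l F) (hsq : Squarefree s.charpoly) :
    IsUnit (s - 1).det := by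
  refine isUnit_det_sub_one_of_squarefree_charpoly (det_eq_one hs) (by simp) ?_ hsq
  have h : s⁻¹ = (-J l F) * sᵀ * J l F := (inv_eq_symplectic_inv s hs)
  rw [h, charpoly_mul_comm, ← Matrix.mul_assoc, Matrix.mul_neg, J_squared, neg_neg, Matrix.one_mul,
    charpoly_transpose]

theorem LinearMap.BilinForm.IsAlt.exists_hyperbolic_family {F V : Type*} [Field F] [AddCommGroup V]
    [Module F V] [FiniteDimensional F V] {B : LinearMap.BilinForm F V} (hB : B.IsAlt)
    (hnd : B.Nondegenerate) (k : ℕ) (hk : 2 * k ≤ Module.finrank F V) :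
    ∃ v w : Fin k → V, (∀ i j, B (v i) (v j) = 0) ∧ (∀ i j, B (w i) (w j) = 0) ∧
      ∀ i j, B (v i) (w j) = if i = j then 1 else 0 := by
  induction k with
  | zero => exact ⟨0, 0, by simp, by simp, by simp⟩
  | succ k ih =>
    obtain ⟨v, w, hvv, hww, hvw⟩ := ih (by omega)
    have hwv (i j) : B (w i) (v j) = if i = j then -1 else 0 := by
      rw [← hB.neg_eq, hvw]; grind
    let φ : V →ₗ[F] (Fin k ⊕ Fin k → F) :=
      LinearMap.pi (Sum.elim (fun i => B (v i)) fun i => B (w i))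
    obtain ⟨e, he, he0⟩ := (Submodule.ne_bot_iff _).1
      (LinearMap.ker_ne_bot_of_finrank_lt (f := φ) (by simp; omega))
    rw [LinearMap.mem_ker, funext_iff] at he
    have hve (i) : B (v i) e = 0 := he (Sum.inl i)
    have hwe (i) : B (w i) e = 0 := he (Sum.inr i)
    have hev (i) : B e (v i) = 0 := by rw [← hB.neg_eq, hve, neg_zero]
    have hew (i) : B e (w i) = 0 := by rw [← hB.neg_eq, hwe, neg_zero]
    obtain ⟨f₀, hf₀⟩ : ∃ f₀, B e f₀ ≠ 0 := by
      by_contra! h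
      exact he0 (hnd.1 e h)
    obtain ⟨f, hef, hvf, hwf⟩ : ∃ f, B e f = 1 ∧ (∀ i, B (v i) f = 0) ∧ ∀ i, B (w i) f = 0 := by
      refine ⟨(B e f₀)⁻¹ • (f₀ - ∑ j, B (v j) f₀ • w j + ∑ j, B (w j) f₀ • v j), ?_, ?_, ?_⟩
      · simp [hew, hev, hf₀]
      · intro i; simp [hvw, hvv]
      · intro i; simp [hwv, hww]
    have hfv (i) : B f (v i) = 0 := by rw [← hB.neg_eq, hvf, neg_zero]
    have hfw (i) : B f (w i) = 0 := by rw [← hB.neg_eq, hwf, neg_zero]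
    refine ⟨Fin.cons e v, Fin.cons f w, ?_, ?_, ?_⟩ <;>
      refine Fin.cases ?_ fun i => ?_ <;> refine Fin.cases ?_ fun j => ?_ <;>
      simp [hB.self_eq_zero, *]
    · exact (Fin.succ_ne_zero j).symm

theorem Matrix.exists_isUnit_det_mul_J_mul_transpose {F l : Type*} [Field F] [Fintype l]
    [DecidableEq l] {A : Matrix (l ⊕ l) (l ⊕ l) F} (hA : IsUnit A.det)
    (halt : ∀ x, x ⬝ᵥ A *ᵥ x = 0) :
    ∃ P : Matrix (l ⊕ l) (l ⊕ l) F, IsUnit P.det ∧ P * J l F * Pᵀ = A := by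
  have hB : (Matrix.toBilin' A).IsAlt := fun x => by
    rw [Matrix.toBilin'_apply']; exact halt x
  obtain ⟨v, w, hvv, hww, hvw⟩ := hB.exists_hyperbolic_family
    (LinearMap.BilinForm.nondegenerate_toBilin'_of_det_ne_zero' A hA.ne_zero)
    (Fintype.card l) (by simp; omega)
  let e := Fintype.equivFin l
  let Q : Matrix (l ⊕ l) (l ⊕ l) F := Matrix.of (Sum.elim (w ∘ e) (v ∘ e))
  have hwv (i j) : Matrix.toBilin' A (w i) (v j) = if i = j then -1 else 0 := by
    rw [← hB.neg_eq, hvw]; grind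
  have hQ : Q * A * Qᵀ = J l F := by
    have key (i j) : (Q * A * Qᵀ) i j =
        Matrix.toBilin' A (Sum.elim (w ∘ e) (v ∘ e) i) (Sum.elim (w ∘ e) (v ∘ e) j) := by
      rw [Matrix.toBilin'_apply', Matrix.mul_assoc]
      rw [Matrix.mul_apply']
      congr 1
    ext i j
    rw [key]
    rcases i with i | i <;> rcases j with j | j <;>
      simp [J, hvv, hww, hvw, hwv, Matrix.one_apply]
    split_ifs <;> simp
  have hQu : IsUnit Q.det := by
    have := isUnit_det_J l F
    rw [← hQ, det_mul, det_mul] at this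
    exact isUnit_of_mul_isUnit_left (isUnit_of_mul_isUnit_left this)
  have hQu' : IsUnit Qᵀ.det := by rwa [det_transpose]
  refine ⟨Q⁻¹, isUnit_nonsing_inv_det _ hQu, ?_⟩
  rw [← hQ, transpose_nonsing_inv, Matrix.mul_assoc Q, nonsing_inv_mul_cancel_left _ _ hQu,
    mul_nonsing_inv_cancel_right _ _ hQu']

namespace Matrix

section Congruence

variable {F ι : Type*} [Field F] [Fintype ι]

theorem congr_sub_transpose (g x : Matrix ι ι F) :
    x * g * xᵀ - (x * g * xᵀ)ᵀ = x * (g - gᵀ) * xᵀ := by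
  simp only [transpose_mul, transpose_transpose, Matrix.mul_sub, Matrix.sub_mul, Matrix.mul_assoc]

theorem dotProduct_sub_transpose_mulVec_self (g : Matrix ι ι F) (x : ι → F) :
    x ⬝ᵥ (g - gᵀ) *ᵥ x = 0 := by
  rw [sub_mulVec, dotProduct_sub, mulVec_transpose, dotProduct_comm x (x ᵥ* g), dotProduct_mulVec,
    sub_self]

variable [DecidableEq ι]

theorem congr_mul_transpose_inv (g : Matrix ι ι F) {x : Matrix ι ι F} (hx : IsUnit x.det) :
    (x * g * xᵀ) * (x * g * xᵀ)ᵀ⁻¹ = x * (g * gᵀ⁻¹) * x⁻¹ := by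
  have hx' : IsUnit xᵀ.det := by rwa [det_transpose]
  rw [transpose_mul, transpose_mul, transpose_transpose, mul_inv_rev, mul_inv_rev]
  simp only [Matrix.mul_assoc]
  rw [mul_nonsing_inv_cancel_left _ _ hx']

theorem charpoly_conj (g : Matrix ι ι F) {x : Matrix ι ι F} (hx : IsUnit x.det) :
    (x * g * x⁻¹).charpoly = g.charpoly := by
  rw [charpoly_mul_comm, nonsing_inv_mul_cancel_left _ _ hx]

/-- Invertible matrices, viewed as bilinear forms, whose asymmetry `g * gᵀ⁻¹` has squarefree
characteristic polynomial. -/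
def HasSquarefreeAsymmetry (g : Matrix ι ι F) : Prop :=
  IsUnit g.det ∧ Squarefree (g * gᵀ⁻¹).charpoly

theorem HasSquarefreeAsymmetry.congr {g x : Matrix ι ι F} (hg : g.HasSquarefreeAsymmetry)
    (hx : IsUnit x.det) : (x * g * xᵀ).HasSquarefreeAsymmetry := by
  refine ⟨?_, ?_⟩
  · rw [det_mul, det_mul, det_transpose]
    exact (hx.mul hg.1).mul hx
  · rw [congr_mul_transpose_inv g hx, charpoly_conj _ hx]
    exact hg.2

/-- The square matrices with invertible determinant are the units of the matrix ring. -/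
noncomputable def isUnitDetEquiv : {x : Matrix ι ι F // IsUnit x.det} ≃ GL ι F where
  toFun x := nonsingInvUnit x.1 x.2
  invFun x := ⟨x.1, (isUnit_iff_isUnit_det _).1 x.isUnit⟩
  left_inv _ := rfl
  right_inv _ := Units.ext rfl

theorem charpoly_submatrix_mul_transpose_inv {κ : Type*} [Fintype κ] [DecidableEq κ] (e : κ ≃ ι)
    (g : Matrix ι ι F) :
    (g.submatrix e e * (g.submatrix e e)ᵀ⁻¹).charpoly = (g * gᵀ⁻¹).charpoly := by
  rw [transpose_submatrix, inv_submatrix_equiv, submatrix_mul_equiv]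
  simpa only [reindex_apply, Equiv.symm_symm] using charpoly_reindex e.symm (g * gᵀ⁻¹)

end Congruence

section Symplectic

variable {F l : Type*} [Field F] [Fintype l] [DecidableEq l]

theorem isUnit_det_of_mem_symplecticGroup {s : Matrix (l ⊕ l) (l ⊕ l) F}
    (hs : s ∈ symplecticGroup l F) : IsUnit s.det := SymplecticGroup.symplectic_det hs

theorem HasSquarefreeAsymmetry.exists_congr_J {g : Matrix (l ⊕ l) (l ⊕ l) F}
    (hg : g.HasSquarefreeAsymmetry) :
    ∃ P : Matrix (l ⊕ l) (l ⊕ l) F, IsUnit P.det ∧ P * J l F * Pᵀ = g - gᵀ :=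
  exists_isUnit_det_mul_J_mul_transpose
    (isUnit_det_sub_transpose_of_squarefree hg.1 (by simp) hg.2)
    (dotProduct_sub_transpose_mulVec_self g)

/-- The form with alternating part `J` and asymmetry `s`. -/
noncomputable def cayleyForm (s : Matrix (l ⊕ l) (l ⊕ l) F) : Matrix (l ⊕ l) (l ⊕ l) F :=
  s * (s - 1)⁻¹ * J l F

theorem transpose_cayleyForm {s : Matrix (l ⊕ l) (l ⊕ l) F} (hs : s ∈ symplecticGroup l F)
    (h1 : IsUnit (s - 1).det) : (cayleyForm s)ᵀ = (s - 1)⁻¹ * J l F := by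
  have hJ := isUnit_det_J l F
  have h1' : IsUnit (sᵀ - 1).det := by
    rwa [← transpose_one, ← transpose_sub, det_transpose]
  have hsJ := SymplecticGroup.mem_iff.1 hs
  have e : (s - 1) * (J l F * sᵀ) = -(J l F * (sᵀ - 1)) := by
    rw [Matrix.sub_mul, Matrix.mul_sub, ← Matrix.mul_assoc, hsJ]
    simp
  have e' : J l F * sᵀ = -((s - 1)⁻¹ * J l F * (sᵀ - 1)) := by
    rw [Matrix.mul_assoc, ← Matrix.mul_neg, ← e, nonsing_inv_mul_cancel_left _ _ h1]
  rw [cayleyForm, transpose_mul, transpose_mul, J_transpose, transpose_nonsing_inv, transpose_sub,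
    transpose_one]
  have comm : (sᵀ - 1)⁻¹ * sᵀ = sᵀ * (sᵀ - 1)⁻¹ := by
    rw [← mul_nonsing_inv_cancel_right _ ((sᵀ - 1)⁻¹ * sᵀ) h1', Matrix.mul_assoc _ sᵀ,
      show sᵀ * (sᵀ - 1) = (sᵀ - 1) * sᵀ by noncomm_ring, nonsing_inv_mul_cancel_left _ _ h1']
  rw [comm, Matrix.neg_mul, ← Matrix.mul_assoc, e', Matrix.neg_mul, neg_neg,
    mul_nonsing_inv_cancel_right _ _ h1']

theorem cayleyForm_sub_transpose {s : Matrix (l ⊕ l) (l ⊕ l) F} (hs : s ∈ symplecticGroup l F)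
    (h1 : IsUnit (s - 1).det) : cayleyForm s - (cayleyForm s)ᵀ = J l F := by
  rw [transpose_cayleyForm hs h1, cayleyForm, Matrix.mul_assoc]
  nth_rw 2 [← Matrix.one_mul ((s - 1)⁻¹ * J l F)]
  rw [← Matrix.sub_mul, mul_nonsing_inv_cancel_left _ _ h1]

theorem isUnit_det_cayleyForm {s : Matrix (l ⊕ l) (l ⊕ l) F} (hs : s ∈ symplecticGroup l F)
    (h1 : IsUnit (s - 1).det) : IsUnit (cayleyForm s).det := by
  rw [cayleyForm, det_mul, det_mul]
  exact ((isUnit_det_of_mem_symplecticGroup hs).mul (isUnit_nonsing_inv_det _ h1)).mul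
    (isUnit_det_J l F)

theorem cayleyForm_mul_transpose_inv {s : Matrix (l ⊕ l) (l ⊕ l) F} (hs : s ∈ symplecticGroup l F)
    (h1 : IsUnit (s - 1).det) : cayleyForm s * (cayleyForm s)ᵀ⁻¹ = s := by
  have hg : IsUnit (cayleyForm s)ᵀ.det := by
    rw [det_transpose]; exact isUnit_det_cayleyForm hs h1
  have e : cayleyForm s = s * (cayleyForm s)ᵀ := by
    rw [transpose_cayleyForm hs h1, cayleyForm, Matrix.mul_assoc]
  nth_rw 1 [e]
  rw [mul_nonsing_inv_cancel_right _ _ hg]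

theorem mul_transpose_inv_mem_symplecticGroup {g : Matrix (l ⊕ l) (l ⊕ l) F} (hg : IsUnit g.det)
    (hJ : g - gᵀ = J l F) : g * gᵀ⁻¹ ∈ symplecticGroup l F := by
  have hg' : IsUnit gᵀ.det := by rwa [det_transpose]
  rw [SymplecticGroup.mem_iff, ← hJ, transpose_mul, transpose_nonsing_inv, transpose_transpose,
    Matrix.mul_sub, nonsing_inv_mul_cancel_right _ _ hg', Matrix.sub_mul,
    mul_nonsing_inv_cancel_left _ _ hg]
  rw [Matrix.mul_assoc _ g, mul_nonsing_inv_cancel_left _ _ hg,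
    nonsing_inv_mul_cancel_right _ _ hg']

theorem cayleyForm_mul_transpose_inv_eq {g : Matrix (l ⊕ l) (l ⊕ l) F} (hg : IsUnit g.det)
    (hJ : g - gᵀ = J l F) : cayleyForm (g * gᵀ⁻¹) = g := by
  have hg' : IsUnit gᵀ.det := by rwa [det_transpose]
  have e : g * gᵀ⁻¹ - 1 = J l F * gᵀ⁻¹ := by
    rw [← hJ, Matrix.sub_mul, mul_nonsing_inv _ hg']
  rw [cayleyForm, e, mul_inv_rev, nonsing_inv_nonsing_inv _ hg', Matrix.mul_assoc,
    nonsing_inv_mul_cancel_right _ _ (isUnit_det_J l F), nonsing_inv_mul_cancel_right _ _ hg']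

variable (F l) in
/-- Forms with alternating part `J` and squarefree asymmetry correspond to their asymmetries. -/
noncomputable def asymmetryEquiv :
    {g : Matrix (l ⊕ l) (l ⊕ l) F // g.HasSquarefreeAsymmetry ∧ g - gᵀ = J l F} ≃
      {s : Matrix (l ⊕ l) (l ⊕ l) F // s ∈ symplecticGroup l F ∧ Squarefree s.charpoly} where
  toFun g := ⟨g.1 * g.1ᵀ⁻¹, mul_transpose_inv_mem_symplecticGroup g.2.1.1 g.2.2, g.2.1.2⟩
  invFun s :=
    have h1 := SymplecticGroup.isUnit_det_sub_one s.2.1 s.2.2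
    ⟨cayleyForm s.1, ⟨isUnit_det_cayleyForm s.2.1 h1, by
      rw [cayleyForm_mul_transpose_inv s.2.1 h1]; exact s.2.2⟩,
      cayleyForm_sub_transpose s.2.1 h1⟩
  left_inv g := Subtype.ext (cayleyForm_mul_transpose_inv_eq g.2.1.1 g.2.2)
  right_inv s := Subtype.ext (cayleyForm_mul_transpose_inv s.2.1
    (SymplecticGroup.isUnit_det_sub_one s.2.1 s.2.2))

theorem mem_symplecticGroup_of_congr_J_eq {x y : Matrix (l ⊕ l) (l ⊕ l) F} (hx : IsUnit x.det)
    (h : x * J l F * xᵀ = y * J l F * yᵀ) : x⁻¹ * y ∈ symplecticGroup l F := by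
  have hx' : IsUnit xᵀ.det := by rwa [det_transpose]
  rw [SymplecticGroup.mem_iff, transpose_mul, transpose_nonsing_inv]
  calc x⁻¹ * y * J l F * (yᵀ * xᵀ⁻¹) = x⁻¹ * (y * J l F * yᵀ) * xᵀ⁻¹ := by
        simp only [Matrix.mul_assoc]
    _ = J l F := by
        rw [← h, Matrix.mul_assoc x, nonsing_inv_mul_cancel_left _ _ hx,
          mul_nonsing_inv_cancel_right _ _ hx']

variable (F l) in
/-- A form together with a symplectic basis for its alternating part: either the form comes first
and the symplectic group acts on the bases, or the basis comes first and transports the form. -/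
noncomputable def congruenceEquiv :
    {g : Matrix (l ⊕ l) (l ⊕ l) F // g.HasSquarefreeAsymmetry} × symplecticGroup l F ≃
      {g : Matrix (l ⊕ l) (l ⊕ l) F // g.HasSquarefreeAsymmetry ∧ g - gᵀ = J l F} ×
        {x : Matrix (l ⊕ l) (l ⊕ l) F // IsUnit x.det} := by
  choose P hPu hP using fun g : {g : Matrix (l ⊕ l) (l ⊕ l) F // g.HasSquarefreeAsymmetry} =>
    g.2.exists_congr_J
  have hx (g) (t : symplecticGroup l F) : IsUnit (P g * t.1).det := by
    rw [det_mul]; exact (hPu g).mul (isUnit_det_of_mem_symplecticGroup t.2)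
  have cancel {x : Matrix (l ⊕ l) (l ⊕ l) F} (h : IsUnit x.det) (g) :
      x⁻¹ * (x * g * xᵀ) * x⁻¹ᵀ = g := by
    rw [Matrix.mul_assoc x, nonsing_inv_mul_cancel_left _ _ h, Matrix.mul_assoc, ← transpose_mul,
      nonsing_inv_mul _ h, transpose_one, Matrix.mul_one]
  have cancel' {x : Matrix (l ⊕ l) (l ⊕ l) F} (h : IsUnit x.det) (g) :
      x * (x⁻¹ * g * x⁻¹ᵀ) * xᵀ = g := by
    rw [Matrix.mul_assoc x⁻¹, mul_nonsing_inv_cancel_left _ _ h, Matrix.mul_assoc, ← transpose_mul,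
      mul_nonsing_inv _ h, transpose_one, Matrix.mul_one]
  have hPt (g) (t : symplecticGroup l F) : (P g * t.1) * J l F * (P g * t.1)ᵀ = g.1 - g.1ᵀ := by
    calc (P g * t.1) * J l F * (P g * t.1)ᵀ = P g * (t.1 * J l F * t.1ᵀ) * (P g)ᵀ := by
          simp only [transpose_mul, Matrix.mul_assoc]
      _ = g.1 - g.1ᵀ := by rw [SymplecticGroup.mem_iff.1 t.2, hP]
  refine
    { toFun := fun p =>
        (⟨(P p.1 * p.2.1)⁻¹ * p.1.1 * (P p.1 * p.2.1)⁻¹ᵀ,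
          p.1.2.congr (isUnit_nonsing_inv_det _ (hx _ _)), by
            rw [congr_sub_transpose, ← hPt p.1 p.2, cancel (hx _ _)]⟩,
          ⟨P p.1 * p.2.1, hx _ _⟩)
      invFun := fun p =>
        (⟨p.2.1 * p.1.1 * p.2.1ᵀ, p.1.2.1.congr p.2.2⟩,
          ⟨(P ⟨p.2.1 * p.1.1 * p.2.1ᵀ, p.1.2.1.congr p.2.2⟩)⁻¹ * p.2.1,
            mem_symplecticGroup_of_congr_J_eq (hPu _) (by
              rw [hP, congr_sub_transpose, p.1.2.2])⟩)
      left_inv := ?_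
      right_inv := ?_ }
  · rintro ⟨g, t⟩
    have e : (⟨_, (g.2.congr (isUnit_nonsing_inv_det _ (hx g t))).congr (hx g t)⟩ :
        {g : Matrix (l ⊕ l) (l ⊕ l) F // g.HasSquarefreeAsymmetry}) = g :=
      Subtype.ext (cancel' (hx g t) g.1)
    refine Prod.ext e (Subtype.ext ?_)
    dsimp only
    rw [e, nonsing_inv_mul_cancel_left _ _ (hPu _)]
  · rintro ⟨g, x⟩
    have e (y) : P y * ((P y)⁻¹ * x.1) = x.1 := mul_nonsing_inv_cancel_left _ _ (hPu y)
    refine Prod.ext (Subtype.ext ?_) (Subtype.ext ?_)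
    · dsimp only
      rw [e, cancel x.2]
    · exact e _

end Symplectic

end Matrix

theorem stmt5 (q n : ℕ) (hq : IsPrimePow q) (hn : 1 ≤ n)
    (F : Type) [Field F] [Fintype F] (hF : Fintype.card F = q) :
    Nat.card {g : GL (Fin (2 * n)) F // Squarefree ((g * tau g).val.charpoly)} *
      Nat.card (Matrix.symplecticGroup (Fin n) F) =
    Nat.card {s : Matrix (Fin n ⊕ Fin n) (Fin n ⊕ Fin n) F //
        s ∈ Matrix.symplecticGroup (Fin n) F ∧ Squarefree s.charpoly} *
      Nat.card (GL (Fin (2 * n)) F) := by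
  let e : Fin (2 * n) ≃ Fin n ⊕ Fin n := (finCongr (two_mul n)).trans finSumFinEquiv.symm
  let E : {x : Matrix (Fin n ⊕ Fin n) (Fin n ⊕ Fin n) F // IsUnit x.det} ≃ GL (Fin (2 * n)) F :=
    ((reindex e e).symm.subtypeEquiv fun x => by
      rw [reindex_symm, det_reindex_self]).trans isUnitDetEquiv
  have hE (x) : (E x * tau (E x)).val.charpoly = (x.1 * x.1ᵀ⁻¹).charpoly := by
    have hx : (E x).val = x.1.submatrix e e := rfl
    rw [Units.val_mul, coe_tau, hx, charpoly_submatrix_mul_transpose_inv]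
  let E' : {g : Matrix (Fin n ⊕ Fin n) (Fin n ⊕ Fin n) F // g.HasSquarefreeAsymmetry} ≃
      {g : GL (Fin (2 * n)) F // Squarefree ((g * tau g).val.charpoly)} :=
    (Equiv.subtypeSubtypeEquivSubtypeInter
      (fun g : Matrix (Fin n ⊕ Fin n) (Fin n ⊕ Fin n) F => IsUnit g.det)
      fun g => Squarefree (g * gᵀ⁻¹).charpoly).symm.trans
        (E.subtypeEquiv fun x => by rw [hE])
  rw [← Nat.card_congr E, ← Nat.card_congr E', ← Nat.card_congr (asymmetryEquiv F (Fin n)),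
    ← Nat.card_prod, ← Nat.card_prod]
  exact Nat.card_congr (congruenceEquiv F (Fin n))
end

section
/- Let q be a prime power, n ≥ 1, and let h ∈ GL(2n,F_q) satisfy det(h - 1) ≠ 0 (i.e. 1 is not an eigenvalue of h). Then #{g ∈ GL(2n,F_q) : g·g^τ is conjugate to h in GL(2n,F_q)} · |Sp(2n,F_q)| = #{s ∈ Sp(2n,F_q) : s is conjugate to h in GL(2n,F_q)} · |GL(2n,F_q)|; that is, the chance that g·g^τ lies in the GL(2n,F_q)-conjugacy class of h, for g chosen uniformly at random in GL(2n,F_q), equals the chance that a uniformly random element of Sp(2n,F_q) lies in that class. -/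
open Matrix Polynomial

section Counting

/-- A map all of whose fibres are equivalent to `γ` has domain `β × γ`. -/
theorem card_eq_mul_of_fiber_equiv {α β γ : Type*} (f : α → β)
    (e : ∀ b, Nonempty ({a // f a = b} ≃ γ)) : Nat.card α = Nat.card β * Nat.card γ := by
  rw [← Nat.card_prod]
  exact Nat.card_congr ((Equiv.sigmaFiberEquiv f).symm.trans
    ((Equiv.sigmaCongrRight fun b => (e b).some).trans (Equiv.sigmaEquivProd β γ)))

variable {G : Type*} [Group G]

theorem card_twisted_conj_mul_card_centralizer (τ : G →* G) (hτ : ∀ g, τ (τ g) = g) (h : G) :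
    Nat.card {g : G // ∃ c, c * (g * τ g) * c⁻¹ = h} * Nat.card {z : G // z * h * z⁻¹ = h} =
      Nat.card {k : G // k * τ k = h} * Nat.card G := by
  have h₁ := card_eq_mul_of_fiber_equiv (γ := {z : G // z * h * z⁻¹ = h})
    (fun p : {p : G × G // p.2 * (p.1 * τ p.1) * p.2⁻¹ = h} =>
      (⟨p.1.1, p.1.2, p.2⟩ : {g : G // ∃ c, c * (g * τ g) * c⁻¹ = h})) (by
    rintro ⟨g, c₀, hc₀⟩
    refine ⟨⟨fun p => ⟨p.1.1.2 * c₀⁻¹, ?_⟩, fun z => ⟨⟨(g, z.1 * c₀), ?_⟩, rfl⟩, ?_, ?_⟩⟩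
    · obtain ⟨⟨⟨g', c⟩, hc⟩, hp⟩ := p
      obtain rfl : g' = g := congrArg Subtype.val hp
      dsimp only at hc ⊢
      rw [← hc₀]
      conv_rhs => rw [hc₀, ← hc]
      group
    · obtain ⟨z, hz⟩ := z
      rw [← hc₀] at hz
      conv_rhs => rw [← hc₀, ← hz]
      group
    · rintro ⟨⟨⟨g', c⟩, hc⟩, hp⟩
      obtain rfl : g' = g := congrArg Subtype.val hp
      simp
    · rintro ⟨z, hz⟩
      simp)
  rw [← h₁, ← Nat.card_prod]
  refine Nat.card_congr ⟨fun p => (⟨p.1.2 * p.1.1 * (τ p.1.2)⁻¹, ?_⟩, p.1.2),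
    fun k => ⟨(k.2⁻¹ * k.1.1 * τ k.2, k.2), ?_⟩, ?_, ?_⟩
  · have hp := p.2
    simp only [map_mul, map_inv, hτ]
    conv_rhs => rw [← hp]
    group
  · have hk := k.1.2
    simp only [map_mul, map_inv, hτ]
    conv_rhs => rw [← hk]
    group
  · rintro ⟨⟨g, c⟩, hc⟩
    simp [mul_assoc]
  · rintro ⟨⟨k, hk⟩, c⟩
    simp [mul_assoc]

theorem card_conj_stabilizer_mul_card_centralizer (τ : G →* G) (h j : G) :
    Nat.card {s : G // s * j * (τ s)⁻¹ = j ∧ ∃ c, s = c * h * c⁻¹} *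
        Nat.card {z : G // z * h * z⁻¹ = h} =
      Nat.card {k : G // (∃ c, c * k * (τ c)⁻¹ = j) ∧ h * k * (τ h)⁻¹ = k} *
        Nat.card {s : G // s * j * (τ s)⁻¹ = j} := by
  have h₁ := card_eq_mul_of_fiber_equiv (γ := {z : G // z * h * z⁻¹ = h})
    (fun c : {c : G // c * h * c⁻¹ * j * (τ (c * h * c⁻¹))⁻¹ = j} =>
      (⟨c.1 * h * c.1⁻¹, c.2, c.1, rfl⟩ :
        {s : G // s * j * (τ s)⁻¹ = j ∧ ∃ c, s = c * h * c⁻¹})) (by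
    rintro ⟨s, hs, c₀, rfl⟩
    refine ⟨⟨fun c => ⟨c₀⁻¹ * c.1.1, ?_⟩, fun z => ⟨⟨c₀ * z.1, ?_⟩, ?_⟩, ?_, ?_⟩⟩
    · have hc := congrArg Subtype.val c.2
      dsimp only at hc
      calc _ = c₀⁻¹ * (c.1.1 * h * c.1.1⁻¹) * c₀ := by group
        _ = _ := by rw [hc]; group
    · have hz : c₀ * z.1 * h * (c₀ * z.1)⁻¹ = c₀ * h * c₀⁻¹ := by
        conv_rhs => rw [← z.2]
        group
      rw [hz, hs]
    · obtain ⟨z, hz⟩ := z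
      ext
      dsimp only
      conv_rhs => rw [← hz]
      group
    · rintro ⟨⟨c, hc⟩, hp⟩
      simp
    · rintro ⟨z, hz⟩
      simp)
  have h₂ := card_eq_mul_of_fiber_equiv (γ := {s : G // s * j * (τ s)⁻¹ = j})
    (fun c : {c : G // c * h * c⁻¹ * j * (τ (c * h * c⁻¹))⁻¹ = j} =>
      (⟨c.1⁻¹ * j * τ c.1, ⟨c.1, by group⟩, by
        obtain ⟨c, hc⟩ := c
        simp only [map_mul, map_inv] at hc
        dsimp only
        conv_rhs => rw [← hc]
        group⟩ :
        {k : G // (∃ c, c * k * (τ c)⁻¹ = j) ∧ h * k * (τ h)⁻¹ = k})) (by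
    rintro ⟨k, ⟨c₀, hc₀⟩, hk⟩
    refine ⟨⟨fun c => ⟨c.1.1 * c₀⁻¹, ?_⟩, fun s => ⟨⟨s.1 * c₀, ?_⟩, ?_⟩, ?_, ?_⟩⟩
    · obtain ⟨⟨c, -⟩, hp⟩ := c
      have hc : c⁻¹ * j * τ c = k := congrArg Subtype.val hp
      dsimp only
      clear hp
      conv_lhs => rw [← hc₀, ← hc]
      simp only [map_mul, map_inv]
      group
    · obtain ⟨s, hs⟩ := s
      have hk' : k = c₀⁻¹ * j * τ c₀ := by rw [← hc₀]; group
      have hj : s⁻¹ * j * τ s = j := by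
        conv_lhs => rw [← hs]
        group
      calc _ = s * c₀ * (h * (c₀⁻¹ * (s⁻¹ * j * τ s) * τ c₀) * (τ h)⁻¹) *
            (τ c₀)⁻¹ * (τ s)⁻¹ := by
            simp only [map_mul, map_inv]; group
        _ = s * (c₀ * k * (τ c₀)⁻¹) * (τ s)⁻¹ := by
            rw [hj, ← hk', hk]; group
        _ = j := by rw [hc₀, hs]
    · obtain ⟨s, hs⟩ := s
      ext
      have hk' : k = c₀⁻¹ * j * τ c₀ := by rw [← hc₀]; group
      have hj : s⁻¹ * j * τ s = j := by
        conv_lhs => rw [← hs]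
        group
      dsimp only
      rw [hk']
      conv_rhs => rw [← hj]
      simp only [map_mul]
      group
    · rintro ⟨⟨c, hc⟩, hp⟩
      simp
    · rintro ⟨z, hz⟩
      simp)
  rw [← h₁, h₂]

end Counting

section SymplecticBasis

variable {K V : Type*} [Field K] [AddCommGroup V] [Module K V] [FiniteDimensional K V]

theorem exists_symplectic_family {B : LinearMap.BilinForm K V} (hB : B.IsAlt)
    (hnd : ∀ x, (∀ y, B x y = 0) → x = 0) (n : ℕ) (hn : n + n ≤ Module.finrank K V) :
    ∃ v : Fin n ⊕ Fin n → V, ∀ i j, B (v i) (v j) = Matrix.J (Fin n) K i j := by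
  induction n with
  | zero => exact ⟨fun _ => 0, fun i => i.elim Fin.elim0 Fin.elim0⟩
  | succ k ih =>
    obtain ⟨v, hv⟩ := ih (by omega)
    obtain ⟨x, hx, hx0⟩ : ∃ x ∈ LinearMap.ker (LinearMap.pi fun i => B (v i)), x ≠ 0 := by
      refine Submodule.exists_mem_ne_zero_of_ne_bot (LinearMap.ker_ne_bot_of_finrank_lt ?_)
      simp
      omega
    have hvx (i) : B (v i) x = 0 := congrFun (LinearMap.mem_ker.1 hx) i
    have hxv (i) : B x (v i) = 0 := by rw [← hB.neg_eq, hvx, neg_zero]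
    obtain ⟨y, hy⟩ : ∃ y, B x y = -1 := by
      obtain ⟨y, hy⟩ := not_forall.1 (mt (hnd x) hx0)
      exact ⟨-(B x y)⁻¹ • y, by simp [hy]⟩
    set b : Fin k ⊕ Fin k → K := fun i => B (v i) y with hb
    set y' := y + ∑ i, (Matrix.J (Fin k) K *ᵥ b) i • v i with hy'
    have hxy : B x y' = -1 := by simp [hy', hxv, hy]
    have hyx : B y' x = 1 := by rw [← hB.neg_eq, hxy, neg_neg]
    have hvy (i) : B (v i) y' = 0 := by
      have hJ : Matrix.J (Fin k) K *ᵥ (Matrix.J (Fin k) K *ᵥ b) = -b := by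
        rw [Matrix.mulVec_mulVec, Matrix.J_squared, Matrix.neg_mulVec, Matrix.one_mulVec]
      have := congrFun hJ i
      rw [Matrix.mulVec, dotProduct] at this
      simp only [hy', map_add, map_sum, map_smul, smul_eq_mul, hv]
      simp only [mul_comm _ (Matrix.J (Fin k) K i _), this]
      simp [hb]
    have hyv (i) : B y' (v i) = 0 := by rw [← hB.neg_eq, hvy, neg_zero]
    refine ⟨Sum.elim (Fin.cons x (v ∘ Sum.inl)) (Fin.cons y' (v ∘ Sum.inr)), ?_⟩
    rintro (i | i) (j | j) <;> refine Fin.cases ?_ (fun i => ?_) i <;>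
      refine Fin.cases ?_ (fun j => ?_) j <;>
      simp [hvx, hxv, hxy, hyx, hvy, hyv, hv, hB.self_eq_zero, Matrix.J, Matrix.one_apply,
        Fin.succ_ne_zero, (Fin.succ_ne_zero _).symm]

end SymplecticBasis

section InverseTranspose

variable {n : ℕ} {F : Type} [Field F]

/-- The inverse-transpose automorphism as a group homomorphism. -/
noncomputable def tauHom : GL (Fin n) F →* GL (Fin n) F where
  toFun := tau
  map_one' := by ext : 1; simp [tau]
  map_mul' a b := by ext : 1; simp only [tau, _root_.mul_inv_rev, Units.val_mul, Matrix.transpose_mul]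

theorem tau_tau (g : GL (Fin n) F) : tau (tau g) = g := by
  ext : 1
  exact Matrix.transpose_transpose _

theorem val_inv_tau (g : GL (Fin n) F) : ((tau g)⁻¹).val = g.valᵀ := rfl

theorem mul_mul_inv_tau_eq_iff (c k j : GL (Fin n) F) :
    c * k * (tau c)⁻¹ = j ↔ c.val * k.val * c.valᵀ = j.val := by
  rw [Units.ext_iff, Units.val_mul, Units.val_mul, val_inv_tau]

theorem mul_tau_eq_iff (k h : GL (Fin n) F) : k * tau k = h ↔ k.val = h.val * k.valᵀ := by
  rw [← eq_mul_inv_iff_mul_eq, Units.ext_iff, Units.val_mul, val_inv_tau]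

/-- The standard symplectic matrix on `Fin (n + n)`. -/
noncomputable def stdJ (n : ℕ) (F : Type) [Field F] : GL (Fin (n + n)) F :=
  Matrix.GeneralLinearGroup.mkOfDetNeZero
    (Matrix.reindex finSumFinEquiv finSumFinEquiv (Matrix.J (Fin n) F)) (by
      rw [Matrix.det_reindex_self]
      exact (Matrix.isUnit_det_J (Fin n) F).ne_zero)

theorem val_stdJ : (stdJ n F).val =
    Matrix.reindex finSumFinEquiv finSumFinEquiv (Matrix.J (Fin n) F) := rfl

theorem transpose_stdJ : (stdJ n F).valᵀ = -(stdJ n F).val := by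
  rw [val_stdJ, Matrix.transpose_reindex, Matrix.J_transpose]
  rfl

theorem exists_congr_stdJ (k g : GL (Fin (n + n)) F) (hk : k.val = g.val - g.valᵀ) :
    ∃ c : GL (Fin (n + n)) F, c.val * k.val * c.valᵀ = (stdJ n F).val := by
  set B : LinearMap.BilinForm F (Fin (n + n) → F) := Matrix.toBilin' k.val
  have hBa (x y) : B x y = x ⬝ᵥ k.val *ᵥ y := Matrix.toBilin'_apply' _ _ _
  have halt : B.IsAlt := fun x => by
    rw [hBa, hk, Matrix.sub_mulVec, dotProduct_sub, Matrix.mulVec_transpose,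
      dotProduct_comm x (_ ᵥ* _), ← Matrix.dotProduct_mulVec, sub_self]
  have hnd : ∀ x, (∀ y, B x y = 0) → x = 0 := fun x hx => by
    have : x ᵥ* k.val = 0 := dotProduct_eq_zero _ fun y => by
      rw [← Matrix.dotProduct_mulVec, ← hBa, hx]
    have h' := congrArg (· ᵥ* (k⁻¹).val) this
    simpa only [Matrix.vecMul_vecMul, Units.mul_inv, Matrix.vecMul_one, Matrix.zero_vecMul]
      using h'
  obtain ⟨v, hv⟩ := exists_symplectic_family halt hnd n (by simp)
  set P : Matrix (Fin (n + n)) (Fin (n + n)) F :=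
    Matrix.of fun i => v (finSumFinEquiv.symm i)
  have hPk : P * k.val * Pᵀ = (stdJ n F).val := by
    ext i j
    rw [val_stdJ, Matrix.reindex_apply, Matrix.submatrix_apply, ← hv, hBa, Matrix.mul_assoc,
      Matrix.mul_apply']
    rfl
  have hdet : P.det ≠ 0 := fun h0 => by
    have := congrArg Matrix.det hPk
    rw [Matrix.det_mul, Matrix.det_mul, h0, zero_mul, zero_mul] at this
    exact (Matrix.GeneralLinearGroup.det (stdJ n F)).ne_zero this.symm
  exact ⟨Matrix.GeneralLinearGroup.mkOfDetNeZero P hdet, hPk⟩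

theorem card_asymmetry_eq_card_invariant_alternating (h : GL (Fin (n + n)) F)
    (hh : (h.val - 1).det ≠ 0) :
    Nat.card {k : GL (Fin (n + n)) F // k * tau k = h} =
      Nat.card {k : GL (Fin (n + n)) F //
        (∃ c, c * k * (tau c)⁻¹ = stdJ n F) ∧ h * k * (tau h)⁻¹ = k} := by
  simp only [mul_mul_inv_tau_eq_iff, mul_tau_eq_iff]
  obtain ⟨d, hd⟩ : ∃ d : GL (Fin (n + n)) F, d.val = h.val - 1 :=
    ⟨Matrix.GeneralLinearGroup.mkOfDetNeZero _ hh, rfl⟩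
  have hsub (g : GL (Fin (n + n)) F) (hg : g.val = h.val * g.valᵀ) :
      (d * (tau g)⁻¹).val = g.val - g.valᵀ := by
    rw [Units.val_mul, val_inv_tau, hd, sub_mul, one_mul, ← hg]
  refine Nat.card_eq_of_bijective (fun g => ⟨d * (tau g.1)⁻¹,
    exists_congr_stdJ _ g.1 (hsub g.1 g.2), ?_⟩) ⟨?_, ?_⟩
  · obtain ⟨g, hg⟩ := g
    have hgT : g.valᵀ = g.val * h.valᵀ := by
      conv_lhs => rw [hg, Matrix.transpose_mul, Matrix.transpose_transpose]
    rw [hsub g hg, mul_sub, sub_mul, ← hg, ← hgT, mul_assoc, ← hgT, ← hg]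
  · intro g g' hgg
    have := congrArg Subtype.val hgg
    dsimp only at this
    rw [mul_right_inj, _root_.inv_inj] at this
    ext1
    rw [← tau_tau g.1, this, tau_tau]
  · rintro ⟨k, ⟨c, hc⟩, hk⟩
    have hskew : k.valᵀ = -k.val := by
      have h1 : k = c⁻¹ * stdJ n F * tau c := by
        rw [← (mul_mul_inv_tau_eq_iff c k _).2 hc]; group
      have h2 : k.val = (c⁻¹).val * (stdJ n F).val * (c⁻¹).valᵀ := by rw [h1]; rfl
      rw [h2]
      simp only [Matrix.transpose_mul, Matrix.transpose_transpose, transpose_stdJ]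
      simp [mul_assoc]
    set X := (d⁻¹ * k).val with hX
    have hdX : d.val * X = k.val := by rw [hX, ← Units.val_mul, mul_inv_cancel_left]
    have hXd : Xᵀ * d.valᵀ = -k.val := by rw [← Matrix.transpose_mul, hdX, hskew]
    have hcomm : d.val * h.val = h.val * d.val := by rw [hd]; noncomm_ring
    have hhX : h.val * X * d.valᵀ = -k.val := by
      refine d.isUnit.mul_left_cancel ?_
      calc d.val * (h.val * X * d.valᵀ) = h.val * (d.val * X) * d.valᵀ := by
            rw [← mul_assoc, ← mul_assoc, hcomm, mul_assoc h.val]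
        _ = h.val * k.val * h.valᵀ - h.val * k.val := by
            rw [hdX, hd, Matrix.transpose_sub, Matrix.transpose_one, mul_sub, mul_one]
        _ = d.val * -k.val := by rw [hk, hd]; noncomm_ring
    have hg : (tau (k⁻¹ * d)).val = Xᵀ := by
      rw [hX, ← inv_inv k, ← _root_.mul_inv_rev, inv_inv]; rfl
    refine ⟨⟨tau (k⁻¹ * d), ?_⟩, ?_⟩
    · rw [hg, Matrix.transpose_transpose]
      have hdT : IsUnit d.valᵀ := (Matrix.isUnit_transpose d.val).2 d.isUnit
      exact hdT.mul_right_cancel (hXd.trans hhX.symm)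
    · ext1
      dsimp only
      rw [tau_tau]
      group

theorem card_isometry_stdJ (p : Matrix (Fin (n + n)) (Fin (n + n)) F → Prop) :
    Nat.card {s : GL (Fin (n + n)) F // s * stdJ n F * (tau s)⁻¹ = stdJ n F ∧ p s.val} =
      Nat.card {A : Matrix (Fin n ⊕ Fin n) (Fin n ⊕ Fin n) F //
        A ∈ Matrix.symplecticGroup (Fin n) F ∧
          p (Matrix.reindex finSumFinEquiv finSumFinEquiv A)} := by
  set e := Matrix.reindexAlgEquiv F F (finSumFinEquiv (m := n) (n := n)) with he
  have key (s : GL (Fin (n + n)) F) (A : Matrix (Fin n ⊕ Fin n) (Fin n ⊕ Fin n) F)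
      (hA : e A = s.val) : s * stdJ n F * (tau s)⁻¹ = stdJ n F ↔
        A ∈ Matrix.symplecticGroup (Fin n) F := by
    have hT : s.valᵀ = e Aᵀ := by rw [← hA]; rfl
    have hJ : (stdJ n F).val = e (Matrix.J (Fin n) F) := rfl
    rw [mul_mul_inv_tau_eq_iff, SymplecticGroup.mem_iff, hT, ← hA, hJ, ← map_mul, ← map_mul,
      e.injective.eq_iff]
  refine Nat.card_eq_of_bijective (fun s => ⟨e.symm s.1.val,
    (key _ _ (e.apply_symm_apply _)).1 s.2.1, ?_⟩) ⟨?_, ?_⟩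
  · change p (e (e.symm s.1.val))
    rw [e.apply_symm_apply]
    exact s.2.2
  · intro s t hst
    exact Subtype.ext (Units.ext (e.symm.injective (congrArg Subtype.val hst)))
  · rintro ⟨A, hA, hp⟩
    have hdet : (e A).det ≠ 0 := by
      rw [he, Matrix.det_reindexAlgEquiv]
      exact (SymplecticGroup.symplectic_det hA).ne_zero
    exact ⟨⟨Matrix.GeneralLinearGroup.mkOfDetNeZero (e A) hdet, (key _ A rfl).2 hA, hp⟩,
      Subtype.ext (e.symm_apply_apply A)⟩

end InverseTranspose

theorem stmt7 (q n : ℕ) (hq : IsPrimePow q) (hn : 1 ≤ n)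
    (F : Type) [Field F] [Fintype F] (hF : Fintype.card F = q)
    (h : GL (Fin (n + n)) F) (hh : (h.val - 1).det ≠ 0) :
    Nat.card {g : GL (Fin (n + n)) F //
        ∃ c : GL (Fin (n + n)) F, c * (g * tau g) * c⁻¹ = h} *
      Nat.card (Matrix.symplecticGroup (Fin n) F) =
    Nat.card {s : Matrix (Fin n ⊕ Fin n) (Fin n ⊕ Fin n) F //
        s ∈ Matrix.symplecticGroup (Fin n) F ∧
        ∃ c : GL (Fin (n + n)) F,
          Matrix.reindex finSumFinEquiv finSumFinEquiv s = c.val * h.val * (c⁻¹).val} *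
      Nat.card (GL (Fin (n + n)) F) := by
  have hA := card_twisted_conj_mul_card_centralizer tauHom tau_tau h
  have hS := card_conj_stabilizer_mul_card_centralizer tauHom h (stdJ n F)
  change Nat.card {g : GL (Fin (n + n)) F // ∃ c, c * (g * tau g) * c⁻¹ = h} * _ =
    Nat.card {k : GL (Fin (n + n)) F // k * tau k = h} * _ at hA
  change Nat.card {s : GL (Fin (n + n)) F // s * stdJ n F * (tau s)⁻¹ = stdJ n F ∧
      ∃ c, s = c * h * c⁻¹} * _ =
    Nat.card {k : GL (Fin (n + n)) F //
        (∃ c, c * k * (tau c)⁻¹ = stdJ n F) ∧ h * k * (tau h)⁻¹ = k} *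
    Nat.card {s : GL (Fin (n + n)) F // s * stdJ n F * (tau s)⁻¹ = stdJ n F} at hS
  have hZ : 0 < Nat.card {z : GL (Fin (n + n)) F // z * h * z⁻¹ = h} :=
    Nat.card_pos_iff.2 ⟨⟨1, by simp⟩, inferInstance⟩
  have hSp : Nat.card {s : GL (Fin (n + n)) F // s * stdJ n F * (tau s)⁻¹ = stdJ n F} =
      Nat.card (Matrix.symplecticGroup (Fin n) F) := by
    simpa only [and_true] using card_isometry_stdJ (n := n) (F := F) fun _ => True
  have hconj (s : GL (Fin (n + n)) F) : (∃ c, s = c * h * c⁻¹) ↔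
      ∃ c : GL (Fin (n + n)) F, s.val = c.val * h.val * (c⁻¹).val :=
    exists_congr fun c => Units.ext_iff
  simp_rw [hconj] at hS
  rw [card_isometry_stdJ fun A => ∃ c : GL (Fin (n + n)) F, A = c.val * h.val * (c⁻¹).val] at hS
  rw [← card_asymmetry_eq_card_invariant_alternating h hh, hSp] at hS
  refine Nat.eq_of_mul_eq_mul_right hZ ?_
  rw [mul_right_comm, hA, mul_right_comm, mul_right_comm _ (Nat.card (GL _ F)), hS]
end

section
/- Let q be a prime power, n ≥ 1, let h₀ ∈ GL(2n,F_q) satisfy det(h₀ - 1) ≠ 0, and let h ∈ GL(2n+1,F_q) be the block-diagonal matrix diag(h₀, 1) (so the eigenvalue 1 occurs in h with multiplicity exactly 1). Then #{g ∈ GL(2n+1,F_q) : g·g^τ is conjugate to h in GL(2n+1,F_q)} · |Sp(2n,F_q)| = #{s ∈ Sp(2n,F_q) : s is conjugate to h₀ in GL(2n,F_q)} · |GL(2n+1,F_q)|. -/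
open Matrix Polynomial

/-- Orbit counting along an equivariant map `f : S → T`, restricted to an invariant subset of
`S`. -/
theorem card_fiber_orbit_mul_card_stabilizer {G S T : Type*} [Group G] (a : G → S → S)
    (b : G → T → T) (a_one : ∀ s, a 1 s = s) (a_mul : ∀ g h s, a (g * h) s = a g (a h s))
    (b_one : ∀ t, b 1 t = t) (b_mul : ∀ g h t, b (g * h) t = b g (b h t))
    (P : S → Prop) (hP : ∀ g s, P s → P (a g s)) (f : S → T)
    (hf : ∀ g s, P s → f (a g s) = b g (f s)) (t₀ : T) :
    Nat.card {s // P s ∧ ∃ g, b g (f s) = t₀} * Nat.card {g // b g t₀ = t₀} =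
      Nat.card G * Nat.card {s // P s ∧ f s = t₀} := by
  rw [← Nat.card_prod, ← Nat.card_prod]
  have b_inv {g : G} {t t' : T} (h : b g t = t') : b g⁻¹ t' = t := by
    rw [← h, ← b_mul, inv_mul_cancel, b_one]
  have hsec (s : S) (g : G) (hs : P s ∧ f s = t₀) : ∃ k, b k (f (a g⁻¹ s)) = t₀ :=
    ⟨g, by rw [hf _ _ hs.1, ← b_mul, mul_inv_cancel, b_one, hs.2]⟩
  let c (s : {s // P s ∧ ∃ g, b g (f s) = t₀}) : G := s.2.2.choose
  have hc (s) : b (c s) (f s.1) = t₀ := s.2.2.choose_spec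
  refine Nat.card_congr
    { toFun := fun p => (p.2.1 * c p.1, ⟨a (p.2.1 * c p.1) p.1.1, hP _ _ p.1.2.1, ?_⟩)
      invFun := fun p => (⟨a p.1⁻¹ p.2.1, hP _ _ p.2.2.1, hsec _ _ p.2.2⟩,
        ⟨p.1 * (c ⟨a p.1⁻¹ p.2.1, hP _ _ p.2.2.1, hsec _ _ p.2.2⟩)⁻¹, ?_⟩)
      left_inv := ?_
      right_inv := ?_ }
  · rw [hf _ _ p.1.2.1, b_mul, hc, p.2.2]
  · have h := hc ⟨a p.1⁻¹ p.2.1, hP _ _ p.2.2.1, hsec _ _ p.2.2⟩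
    rw [b_mul, b_inv h, hf _ _ p.2.2.1, ← b_mul, mul_inv_cancel, b_one, p.2.2.2]
  · rintro ⟨s, z⟩
    have h : a (z.1 * c s)⁻¹ (a (z.1 * c s) s.1) = s.1 := by
      rw [← a_mul, inv_mul_cancel, a_one]
    ext
    · exact h
    · simp only [h, Subtype.coe_eta, mul_inv_cancel_right]
  · rintro ⟨g, s⟩
    ext
    · simp
    · simp only [inv_mul_cancel_right, ← a_mul, mul_inv_cancel, a_one]

/-- Existence of a symplectic basis. -/
theorem LinearMap.IsAlt.exists_apply_eq_J {K V : Type*} [Field K] [AddCommGroup V] [Module K V]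
    [FiniteDimensional K V] {B : V →ₗ[K] V →ₗ[K] K} (hB : B.IsAlt)
    (hnd : ∀ x, (∀ y, B x y = 0) → x = 0) {n : ℕ} (hn : Module.finrank K V = n + n) :
    ∃ v : Fin n ⊕ Fin n → V, ∀ i j, B (v i) (v j) = J (Fin n) K i j := by
  induction n generalizing V with
  | zero => exact ⟨fun _ => 0, fun i => i.elim Fin.elim0 Fin.elim0⟩
  | succ n ih =>
    have : Nontrivial V := Module.nontrivial_of_finrank_pos (R := K) (by omega)
    obtain ⟨e, he⟩ := exists_ne (0 : V)
    obtain ⟨y, hy⟩ : ∃ y, B e y ≠ 0 := by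
      by_contra! h
      exact he (hnd e h)
    obtain ⟨f, hef⟩ : ∃ f, B e f = -1 := ⟨-(B e y)⁻¹ • y, by simp [hy]⟩
    have hfe : B f e = 1 := by rw [← hB.neg e f, hef, neg_neg]
    have hee := hB e
    have hff := hB f
    let φ : V →ₗ[K] K × K := (B e).prod (B f)
    have hφ : Function.Surjective φ := fun p =>
      ⟨p.2 • e - p.1 • f, by ext <;> simp [φ, hef, hfe, hee, hff]⟩
    have hrank : Module.finrank K (LinearMap.ker φ) = n + n := by
      have h1 := LinearMap.finrank_range_add_finrank_ker φ
      rw [LinearMap.range_eq_top.2 hφ, finrank_top, Module.finrank_prod, Module.finrank_self] at h1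
      omega
    have hker (w : LinearMap.ker φ) : B e w = 0 ∧ B f w = 0 := by
      simpa [φ] using w.2
    have hker' (w : LinearMap.ker φ) : B w e = 0 ∧ B w f = 0 :=
      ⟨hB.eq_iff.1 (hker w).1, hB.eq_iff.1 (hker w).2⟩
    obtain ⟨v, hv⟩ := ih (V := LinearMap.ker φ) (B := B.domRestrict₁₂ _ _) (fun x => hB x.1)
      (fun x hx => Subtype.ext (hnd x fun z => by
        have hz : z - (B f z • e - B e z • f) ∈ LinearMap.ker φ := by
          simp [φ, hef, hfe, hee, hff]
        have : B x.1 (z - (B f z • e - B e z • f)) = 0 := hx ⟨_, hz⟩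
        simpa [hker' x] using this)) hrank
    simp only [LinearMap.domRestrict₁₂_apply] at hv
    refine ⟨Sum.elim (Fin.cons e fun i => (v (.inl i)).1) (Fin.cons f fun i => (v (.inr i)).1), ?_⟩
    rintro (i | i) (j | j) <;> cases i using Fin.cases <;> cases j using Fin.cases <;>
      simp [J, hef, hfe, hee, hff, hker, hker', hv, Matrix.one_apply, (Fin.succ_ne_zero _).symm]

namespace Matrix

variable {ι K : Type*} [Fintype ι] [Field K]

/-- A matrix is alternating if the bilinear form it defines is. -/
def IsAlternating (M : Matrix ι ι K) : Prop := ∀ x : ι → K, x ⬝ᵥ M *ᵥ x = 0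

theorem IsAlternating.congr {M : Matrix ι ι K} (hM : M.IsAlternating) (c : Matrix ι ι K) :
    (c * M * cᵀ).IsAlternating := fun x => by
  have := hM (cᵀ *ᵥ x)
  rwa [mulVec_transpose, ← dotProduct_mulVec, ← mulVec_transpose, mulVec_mulVec,
    mulVec_mulVec] at this

theorem isAlternating_sub_transpose (M : Matrix ι ι K) : (M - Mᵀ).IsAlternating := fun x => by
  rw [sub_mulVec, dotProduct_sub, mulVec_transpose, dotProduct_comm x (x ᵥ* M),
    ← dotProduct_mulVec, sub_self]

variable [DecidableEq ι]

theorem IsAlternating.isAlt {M : Matrix ι ι K} (hM : M.IsAlternating) :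
    (toLinearMap₂' K M : (ι → K) →ₗ[K] (ι → K) →ₗ[K] K).IsAlt := fun x => by
  rw [toLinearMap₂'_apply']; exact hM x

theorem IsAlternating.transpose_eq_neg {M : Matrix ι ι K} (hM : M.IsAlternating) : Mᵀ = -M := by
  ext i j
  have := hM.isAlt.neg (Pi.single i 1) (Pi.single j 1)
  simpa [toLinearMap₂'_apply'] using this.symm

theorem isAlternating_J (l : Type*) [Fintype l] [DecidableEq l] : (J l K).IsAlternating :=
  fun x => by
  obtain ⟨u, v, rfl⟩ : ∃ u v : l → K, x = Sum.elim u v := ⟨x ∘ .inl, x ∘ .inr, by simp⟩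
  simp [J, fromBlocks_mulVec, neg_mulVec, dotProduct_comm u v]

theorem IsAlternating.exists_mul_mul_transpose_eq_J {n : ℕ} (e : ι ≃ Fin n ⊕ Fin n)
    {M : Matrix ι ι K} (hM : M.IsAlternating) (hdet : IsUnit M.det) :
    ∃ c : GL ι K, c.val * M * c.valᵀ = reindex e.symm e.symm (J (Fin n) K) := by
  have hnd : ∀ x : ι → K, (∀ y : ι → K, toLinearMap₂' K M x y = 0) → x = 0 := fun x hx => by
    have : x ᵥ* M = 0 := by
      ext j
      have := hx (Pi.single j 1)
      rwa [toLinearMap₂'_apply', dotProduct_mulVec, dotProduct_single_one] at this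
    exact eq_zero_of_vecMul_eq_zero hdet.ne_zero this
  obtain ⟨v, hv⟩ := hM.isAlt.exists_apply_eq_J hnd (n := n) (by
    rw [Module.finrank_fintype_fun_eq_card, Fintype.card_congr e]; simp)
  let P : Matrix ι ι K := of fun i => v (e i)
  have hP : P * M * Pᵀ = reindex e.symm e.symm (J (Fin n) K) := by
    ext i j
    rw [reindex_apply, submatrix_apply]
    have := hv (e i) (e j)
    rw [toLinearMap₂'_apply', dotProduct_mulVec] at this
    exact this
  have hPdet : P.det ≠ 0 := fun h => by
    have h2 := congrArg det hP
    rw [det_mul, det_mul, h, zero_mul, zero_mul, det_reindex_self] at h2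
    exact (isUnit_det_J (Fin n) K).ne_zero h2.symm
  exact ⟨GeneralLinearGroup.mkOfDetNeZero P hPdet, hP⟩

/-- `GL` subtypes as subtypes of matrices. -/
theorem card_subtype_GL (p : Matrix ι ι K → Prop) :
    Nat.card {g : GL ι K // p g.val} = Nat.card {M : Matrix ι ι K // IsUnit M.det ∧ p M} :=
  Nat.card_congr
    { toFun := fun g => ⟨g.1.val, (isUnit_iff_isUnit_det _).1 g.1.isUnit, g.2⟩
      invFun := fun M => ⟨nonsingInvUnit M.1 M.2.1, M.2.2⟩
      left_inv := fun _ => Subtype.ext (Units.ext rfl)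
      right_inv := fun _ => rfl }

theorem card_reindex {κ : Type*} [Fintype κ] [DecidableEq κ] (e : ι ≃ κ)
    (p : Matrix κ κ K → Prop) :
    Nat.card {M : Matrix ι ι K // IsUnit M.det ∧ p (reindex e e M)} =
      Nat.card {M : Matrix κ κ K // IsUnit M.det ∧ p M} :=
  Nat.card_congr ((reindex e e).subtypeEquiv fun M => by rw [det_reindex_self])

/-- Counting invertible block-diagonal matrices. -/
theorem card_blockDiagonal {κ : Type*} [Fintype κ] [DecidableEq κ]
    (p : Matrix (ι ⊕ κ) (ι ⊕ κ) K → Prop) (r : Matrix ι ι K → Prop)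
    (hp : ∀ M, p M → M.toBlocks₁₂ = 0 ∧ M.toBlocks₂₁ = 0)
    (hpr : ∀ A D, p (fromBlocks A 0 0 D) ↔ r A) :
    Nat.card {M // IsUnit M.det ∧ p M} =
      Nat.card {A // IsUnit A.det ∧ r A} * Nat.card {D : Matrix κ κ K // IsUnit D.det} := by
  rw [← Nat.card_prod]
  have hM (M) (h : p M) : fromBlocks M.toBlocks₁₁ 0 0 M.toBlocks₂₂ = M := by
    conv_rhs => rw [← fromBlocks_toBlocks M, (hp M h).1, (hp M h).2]
  have hu (M : {M : Matrix (ι ⊕ κ) (ι ⊕ κ) K // IsUnit M.det ∧ p M}) :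
      IsUnit M.1.toBlocks₁₁.det ∧ IsUnit M.1.toBlocks₂₂.det := by
    rw [← IsUnit.mul_iff, ← det_fromBlocks_zero₁₂ _ 0, hM _ M.2.2]
    exact M.2.1
  exact Nat.card_congr
    { toFun := fun M => (⟨M.1.toBlocks₁₁, (hu M).1, by rw [← hpr, hM _ M.2.2]; exact M.2.2⟩,
        ⟨M.1.toBlocks₂₂, (hu M).2⟩)
      invFun := fun x => ⟨fromBlocks x.1.1 0 0 x.2.1,
        by rw [det_fromBlocks_zero₁₂]; exact x.1.2.1.mul x.2.2, (hpr _ _).2 x.1.2.2⟩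
      left_inv := fun M => Subtype.ext (hM _ M.2.2)
      right_inv := fun x => by ext <;> simp }

/-- Conjugation of a matrix. -/
def conjBy (c : GL ι K) (M : Matrix ι ι K) : Matrix ι ι K := c.val * M * (c⁻¹).val

/-- Congruence transform of a matrix. -/
def congrBy (c : GL ι K) (M : Matrix ι ι K) : Matrix ι ι K := c.val * M * c.valᵀ

theorem conjBy_one (M : Matrix ι ι K) : conjBy 1 M = M := by simp [conjBy]

theorem conjBy_mul (c d : GL ι K) (M : Matrix ι ι K) :
    conjBy (c * d) M = conjBy c (conjBy d M) := by
  rw [conjBy, conjBy, conjBy, _root_.mul_inv_rev]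
  simp only [Units.val_mul, Matrix.mul_assoc]

theorem congrBy_one (M : Matrix ι ι K) : congrBy 1 M = M := by simp [congrBy]

theorem congrBy_mul (c d : GL ι K) (M : Matrix ι ι K) :
    congrBy (c * d) M = congrBy c (congrBy d M) := by
  simp only [congrBy, transpose_mul, Units.val_mul, Matrix.mul_assoc]

theorem conjBy_eq_iff {c : GL ι K} {M N : Matrix ι ι K} : conjBy c M = N ↔ c.val * M = N * c.val :=
  Units.mul_inv_eq_iff_eq_mul c

theorem conjBy_congrBy (c : GL ι K) (s M : Matrix ι ι K) :
    conjBy c s * congrBy c M * (conjBy c s)ᵀ = congrBy c (s * M * sᵀ) := by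
  have h : (c.val)ᵀ * (c⁻¹.val)ᵀ = 1 := by rw [← transpose_mul, Units.inv_mul, transpose_one]
  have h' : c⁻¹.val * c.val = 1 := Units.inv_mul c
  simp only [conjBy, congrBy, transpose_mul, Matrix.mul_assoc]
  rw [← Matrix.mul_assoc c⁻¹.val, h', Matrix.one_mul, ← Matrix.mul_assoc (c.val)ᵀ, h,
    Matrix.one_mul]

theorem isUnit_det_congrBy (c : GL ι K) {M : Matrix ι ι K} (hM : IsUnit M.det) :
    IsUnit (congrBy c M).det := by
  have hc := (isUnit_iff_isUnit_det _).1 c.isUnit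
  rw [congrBy, det_mul, det_mul, det_transpose]
  exact (hc.mul hM).mul hc

theorem congrBy_mul_inv_transpose (c : GL ι K) (M : Matrix ι ι K) :
    congrBy c M * ((congrBy c M)⁻¹)ᵀ = conjBy c (M * (M⁻¹)ᵀ) := by
  have h : (c.val)ᵀ * (c⁻¹.val)ᵀ = 1 := by rw [← transpose_mul, Units.inv_mul, transpose_one]
  rw [congrBy, conjBy, mul_inv_rev, mul_inv_rev, transpose_mul, transpose_mul,
    ← transpose_nonsing_inv, transpose_transpose, ← coe_units_inv]
  simp only [Matrix.mul_assoc]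
  rw [← Matrix.mul_assoc (c.val)ᵀ, h, Matrix.one_mul]

/-- The number of `M` with `M * M⁻ᵀ` conjugate to `h`, up to the centralizer of `h`. -/
theorem card_conj_mul_inv_transpose (h : Matrix ι ι K) :
    Nat.card {M : Matrix ι ι K // IsUnit M.det ∧ ∃ c, conjBy c (M * (M⁻¹)ᵀ) = h} *
        Nat.card {c : GL ι K // conjBy c h = h} =
      Nat.card (GL ι K) * Nat.card {M : Matrix ι ι K // IsUnit M.det ∧ M * (M⁻¹)ᵀ = h} :=
  card_fiber_orbit_mul_card_stabilizer congrBy conjBy congrBy_one congrBy_mul conjBy_one conjBy_mul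
    (fun M => IsUnit M.det) (fun c _ => isUnit_det_congrBy c) (fun M => M * (M⁻¹)ᵀ)
    (fun c M _ => congrBy_mul_inv_transpose c M) h

/-- `p.2` is a nondegenerate alternating form preserved by `p.1`. -/
def IsSymplecticPair (p : Matrix ι ι K × Matrix ι ι K) : Prop :=
  p.1 * p.2 * p.1ᵀ = p.2 ∧ p.2.IsAlternating ∧ IsUnit p.2.det

theorem IsSymplecticPair.act {p : Matrix ι ι K × Matrix ι ι K} (hp : IsSymplecticPair p)
    (c : GL ι K) : IsSymplecticPair (conjBy c p.1, congrBy c p.2) :=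
  ⟨by rw [conjBy_congrBy, hp.1], hp.2.1.congr c.val, isUnit_det_congrBy c hp.2.2⟩

theorem card_symplecticPair_conj_mul_card_centralizer (h : Matrix ι ι K) :
    Nat.card {p : Matrix ι ι K × Matrix ι ι K // IsSymplecticPair p ∧ ∃ c, conjBy c p.1 = h} *
        Nat.card {c : GL ι K // conjBy c h = h} =
      Nat.card (GL ι K) *
        Nat.card {p : Matrix ι ι K × Matrix ι ι K // IsSymplecticPair p ∧ p.1 = h} :=
  card_fiber_orbit_mul_card_stabilizer (fun c p => (conjBy c p.1, congrBy c p.2)) conjBy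
    (fun p => by simp [conjBy_one, congrBy_one]) (fun c d p => by simp [conjBy_mul, congrBy_mul])
    conjBy_one conjBy_mul IsSymplecticPair (fun c _ hp => hp.act c) Prod.fst (fun _ _ _ => rfl) h

theorem card_symplecticPair_conj_mul_card_symplecticGroup {n : ℕ} (e : ι ≃ Fin n ⊕ Fin n)
    (h : Matrix ι ι K) :
    Nat.card {p : Matrix ι ι K × Matrix ι ι K // IsSymplecticPair p ∧ ∃ c, conjBy c p.1 = h} *
        Nat.card (symplecticGroup (Fin n) K) =
      Nat.card (GL ι K) * Nat.card {s : Matrix (Fin n ⊕ Fin n) (Fin n ⊕ Fin n) K //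
        s ∈ symplecticGroup (Fin n) K ∧ ∃ c : GL ι K, conjBy c (reindex e.symm e.symm s) = h} := by
  set J' := reindex e.symm e.symm (J (Fin n) K) with hJ'
  have hJalt : J'.IsAlternating := fun x => by
    have := isAlternating_J (K := K) (Fin n) (x ∘ e.symm)
    rwa [hJ', reindex_apply, submatrix_mulVec_equiv, dotProduct_comp_equiv_symm] at *
  have hJdet : IsUnit J'.det := by
    rw [hJ', det_reindex_self]; exact isUnit_det_J _ _
  have hmem (s : Matrix (Fin n ⊕ Fin n) (Fin n ⊕ Fin n) K) :
      s ∈ symplecticGroup (Fin n) K ↔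
        reindex e.symm e.symm s * J' * (reindex e.symm e.symm s)ᵀ = J' := by
    rw [SymplecticGroup.mem_iff, hJ']
    simp only [reindex_apply, transpose_submatrix, submatrix_mul_equiv]
    exact (reindex e.symm e.symm).injective.eq_iff.symm
  have key := card_fiber_orbit_mul_card_stabilizer
    (fun (c : GL ι K) (p : Matrix ι ι K × Matrix ι ι K) => (conjBy c p.1, congrBy c p.2)) congrBy
    (fun p => by simp [conjBy_one, congrBy_one]) (fun c d p => by simp [conjBy_mul, congrBy_mul])
    congrBy_one congrBy_mul (fun p => IsSymplecticPair p ∧ ∃ c, conjBy c p.1 = h)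
    (fun c p ⟨hp, d, hd⟩ => ⟨hp.act c, d * c⁻¹, by rw [← conjBy_mul, inv_mul_cancel_right, hd]⟩)
    Prod.snd (fun _ _ _ => rfl) J'
  have hleft : Nat.card {p : Matrix ι ι K × Matrix ι ι K //
      (IsSymplecticPair p ∧ ∃ c, conjBy c p.1 = h) ∧ ∃ c, congrBy c p.2 = J'} =
      Nat.card {p : Matrix ι ι K × Matrix ι ι K // IsSymplecticPair p ∧ ∃ c, conjBy c p.1 = h} :=
    Nat.card_congr (Equiv.subtypeEquivRight fun p =>
      and_iff_left_of_imp fun hp => hp.1.2.1.exists_mul_mul_transpose_eq_J e hp.1.2.2)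
  have hstab : Nat.card {c : GL ι K // congrBy c J' = J'} =
      Nat.card (symplecticGroup (Fin n) K) := by
    refine (card_subtype_GL (fun c => c * J' * cᵀ = J')).trans
      (Nat.card_congr ((reindex e.symm e.symm).subtypeEquiv fun s => ?_)).symm
    rw [hmem, iff_and_self]
    intro hs
    have := congrArg det hs
    rw [det_mul, det_mul] at this
    refine isUnit_iff_ne_zero.2 fun h0 => hJdet.ne_zero ?_
    rw [← this, h0, zero_mul, zero_mul]
  have hright : Nat.card {p : Matrix ι ι K × Matrix ι ι K //
      (IsSymplecticPair p ∧ ∃ c, conjBy c p.1 = h) ∧ p.2 = J'} =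
      Nat.card {s : Matrix (Fin n ⊕ Fin n) (Fin n ⊕ Fin n) K //
        s ∈ symplecticGroup (Fin n) K ∧ ∃ c : GL ι K, conjBy c (reindex e.symm e.symm s) = h} := by
    have hp (p : {p : Matrix ι ι K × Matrix ι ι K //
        (IsSymplecticPair p ∧ ∃ c, conjBy c p.1 = h) ∧ p.2 = J'}) :
        p.1.1 * J' * p.1.1ᵀ = J' := by
      have := p.2.1.1.1
      rwa [p.2.2] at this
    have hre (M : Matrix ι ι K) : reindex e.symm e.symm (reindex e e M) = M := by simp
    have hre' (M : Matrix (Fin n ⊕ Fin n) (Fin n ⊕ Fin n) K) :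
        reindex e e (reindex e.symm e.symm M) = M := by simp
    exact (Nat.card_congr
      { toFun := fun s => ⟨(reindex e.symm e.symm s.1, J'),
          ⟨⟨(hmem _).1 s.2.1, hJalt, hJdet⟩, s.2.2⟩, rfl⟩
        invFun := fun p => ⟨reindex e e p.1.1, by rw [hmem, hre]; exact hp p,
          by rw [hre]; exact p.2.1.2⟩
        left_inv := fun s => Subtype.ext (hre' s.1)
        right_inv := fun p => Subtype.ext (Prod.ext (hre _) p.2.2.symm) }).symm
  rw [← hleft, ← hstab, key, hright]

/-- For `h - 1` invertible, `A ↦ A - Aᵀ` matches the forms of asymmetry `h` with the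
nondegenerate alternating forms preserved by `h`. -/
theorem card_symplecticPair_fst_eq (h : GL ι K) (hh : (h.val - 1).det ≠ 0) :
    Nat.card {p : Matrix ι ι K × Matrix ι ι K // IsSymplecticPair p ∧ p.1 = h.val} =
      Nat.card {A : Matrix ι ι K // IsUnit A.det ∧ A = h.val * Aᵀ} := by
  have hu : IsUnit (h.val - 1).det := isUnit_iff_ne_zero.2 hh
  let d : GL ι K := nonsingInvUnit _ hu
  have hd : d.val = h.val - 1 := rfl
  have hsub {A : Matrix ι ι K} (hA : A = h.val * Aᵀ) : A - Aᵀ = d.val * Aᵀ := by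
    rw [hd, Matrix.sub_mul, ← hA, Matrix.one_mul]
  have hinv {A : Matrix ι ι K} (hA : A = h.val * Aᵀ) : h.val * A * h.valᵀ = A := by
    have : Aᵀ = A * h.valᵀ := by
      conv_lhs => rw [hA, transpose_mul, transpose_transpose]
    rw [Matrix.mul_assoc, ← this, ← hA]
  have hsol {M : Matrix ι ι K} (hM : h.val * M * h.valᵀ = M) (halt : M.IsAlternating) :
      (d⁻¹.val * M)ᵀ = h.val * (d⁻¹.val * M) := by
    have hT := halt.transpose_eq_neg
    have hcomm : d.val * h.val = h.val * d.val := by rw [hd]; noncomm_ring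
    have hcomm' : d⁻¹.val * h.val = h.val * d⁻¹.val := by
      rw [Units.inv_mul_eq_iff_eq_mul, ← Matrix.mul_assoc, hcomm, Matrix.mul_assoc, Units.mul_inv,
        Matrix.mul_one]
    have hdM : h.val * M * d.valᵀ = - (d.val * M) := by
      rw [hd, transpose_sub, transpose_one, Matrix.mul_sub, hM]; noncomm_ring
    have hdd : d.valᵀ * (d⁻¹.val)ᵀ = 1 := by rw [← transpose_mul, Units.inv_mul, transpose_one]
    rw [transpose_mul, hT, ← Matrix.mul_assoc, ← hcomm', Matrix.mul_assoc]
    symm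
    rw [Units.inv_mul_eq_iff_eq_mul]
    calc h.val * M = h.val * M * d.valᵀ * (d⁻¹.val)ᵀ := by
          rw [Matrix.mul_assoc, hdd, Matrix.mul_one]
      _ = d.val * (-M * (d⁻¹.val)ᵀ) := by rw [hdM]; noncomm_ring
  have hp (p : {p : Matrix ι ι K × Matrix ι ι K // IsSymplecticPair p ∧ p.1 = h.val}) :
      (d⁻¹.val * p.1.2)ᵀ = h.val * (d⁻¹.val * p.1.2) := by
    have := p.2.1.1
    rw [p.2.2] at this
    exact hsol this p.2.1.2.1
  have hdu : IsUnit d.val.det := hu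
  have hdu' : IsUnit d⁻¹.val.det := (isUnit_iff_isUnit_det _).1 d⁻¹.isUnit
  exact Nat.card_congr
    { toFun := fun p => ⟨(d⁻¹.val * p.1.2)ᵀ,
        by rw [det_transpose, det_mul]; exact hdu'.mul p.2.1.2.2,
        by rw [transpose_transpose]; exact hp p⟩
      invFun := fun A => ⟨(h.val, A.1 - A.1ᵀ),
        ⟨by
          have := congrArg transpose (hinv A.2.2)
          simp only [transpose_mul, transpose_transpose, ← Matrix.mul_assoc] at this
          rw [Matrix.mul_sub, Matrix.sub_mul, hinv A.2.2, this],
         isAlternating_sub_transpose _,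
         by rw [hsub A.2.2, det_mul, det_transpose]; exact hdu.mul A.2.1⟩, rfl⟩
      left_inv := fun p => Subtype.ext (Prod.ext p.2.2.symm (by
        have h2 := hsub (A := (d⁻¹.val * p.1.2)ᵀ) (by rw [transpose_transpose]; exact hp p)
        change (d⁻¹.val * p.1.2)ᵀ - ((d⁻¹.val * p.1.2)ᵀ)ᵀ = p.1.2
        rw [h2, transpose_transpose, Units.mul_inv_cancel_left]))
      right_inv := fun A => Subtype.ext (by
        change (d⁻¹.val * (A.1 - A.1ᵀ))ᵀ = A.1
        rw [hsub A.2.2, Units.inv_mul_cancel_left, transpose_transpose]) }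

theorem mul_inv_transpose_eq_iff {M h : Matrix ι ι K} (hM : IsUnit M.det) :
    M * (M⁻¹)ᵀ = h ↔ M = h * Mᵀ := by
  have h1 : (M⁻¹)ᵀ * Mᵀ = 1 := by rw [← transpose_mul, mul_nonsing_inv M hM, transpose_one]
  have h2 : Mᵀ * (M⁻¹)ᵀ = 1 := mul_eq_one_comm.1 h1
  constructor
  · rintro rfl
    rw [Matrix.mul_assoc, h1, Matrix.mul_one]
  · intro hM'
    nth_rw 1 [hM']
    rw [Matrix.mul_assoc, h2, Matrix.mul_one]

theorem eq_zero_of_eq_mul {κ : Type*} {h : Matrix ι ι K} (hh : (h - 1).det ≠ 0)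
    {b : Matrix ι κ K} (hb : b = h * b) : b = 0 := by
  have hu : IsUnit (h - 1).det := isUnit_iff_ne_zero.2 hh
  have : (h - 1) * b = 0 := by rw [Matrix.sub_mul, ← hb, Matrix.one_mul, sub_self]
  rw [← nonsing_inv_mul_cancel_left _ b hu, this, Matrix.mul_zero]

theorem eq_zero_of_eq_mul_right {κ : Type*} {h : Matrix ι ι K} (hh : (h - 1).det ≠ 0)
    {b : Matrix κ ι K} (hb : b = b * h) : b = 0 := by
  have hu : IsUnit (h - 1).det := isUnit_iff_ne_zero.2 hh
  have : b * (h - 1) = 0 := by rw [Matrix.mul_sub, ← hb, Matrix.mul_one, sub_self]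
  rw [← mul_nonsing_inv_cancel_right _ b hu, this, Matrix.zero_mul]

/-- The invertible matrices with asymmetry `diag(h,1)`. -/
theorem card_mul_inv_transpose_eq_blockDiagonal {m : ℕ} (e : ι ⊕ Fin 1 ≃ Fin m)
    {h : Matrix ι ι K} (hh : (h - 1).det ≠ 0) :
    Nat.card {M : Matrix (Fin m) (Fin m) K // IsUnit M.det ∧
        M * (M⁻¹)ᵀ = reindex e e (fromBlocks h 0 0 1)} =
      Nat.card {A : Matrix ι ι K // IsUnit A.det ∧ A = h * Aᵀ} *
        Nat.card {D : Matrix (Fin 1) (Fin 1) K // IsUnit D.det} := by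
  rw [← card_blockDiagonal (fun M => M = fromBlocks h 0 0 1 * Mᵀ), ← card_reindex e.symm]
  · refine Nat.card_congr (Equiv.subtypeEquivRight fun M => and_congr_right fun hM => ?_)
    rw [mul_inv_transpose_eq_iff hM, ← (reindex e.symm e.symm).injective.eq_iff]
    simp only [reindex_apply, Equiv.symm_symm, transpose_submatrix]
    rw [← submatrix_mul_equiv _ _ e e e]
    simp
  · intro M hM
    rw [← fromBlocks_toBlocks M, fromBlocks_transpose, fromBlocks_multiply, fromBlocks_inj] at hM
    simp only [Matrix.zero_mul, Matrix.one_mul, add_zero, zero_add] at hM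
    have h12 : M.toBlocks₁₂ = 0 := eq_zero_of_eq_mul hh <| by
      conv_lhs => rw [hM.2.1, hM.2.2.1, transpose_transpose]
    exact ⟨h12, by rw [hM.2.2.1, h12, transpose_zero]⟩
  · intro A D
    rw [fromBlocks_transpose, fromBlocks_multiply, fromBlocks_inj]
    have hD : Dᵀ = D := by ext i j; rw [Subsingleton.elim i j, transpose_apply]
    simp [hD]

/-- The centralizer of `diag(h,1)`. -/
theorem card_centralizer_blockDiagonal {m : ℕ} (e : ι ⊕ Fin 1 ≃ Fin m)
    {h : Matrix ι ι K} (hh : (h - 1).det ≠ 0) :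
    Nat.card {c : GL (Fin m) K // conjBy c (reindex e e (fromBlocks h 0 0 1)) =
        reindex e e (fromBlocks h 0 0 1)} =
      Nat.card {c : GL ι K // conjBy c h = h} *
        Nat.card {D : Matrix (Fin 1) (Fin 1) K // IsUnit D.det} := by
  simp only [conjBy_eq_iff]
  rw [card_subtype_GL (fun A => A * h = h * A),
    card_subtype_GL (fun M => M * reindex e e (fromBlocks h 0 0 1) =
      reindex e e (fromBlocks h 0 0 1) * M),
    ← card_blockDiagonal (fun M => M * fromBlocks h 0 0 1 = fromBlocks h 0 0 1 * M),
    ← card_reindex e.symm]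
  · refine Nat.card_congr (Equiv.subtypeEquivRight fun M => and_congr_right fun _ => ?_)
    rw [← (reindex e.symm e.symm).injective.eq_iff]
    simp only [reindex_apply, Equiv.symm_symm]
    rw [← submatrix_mul_equiv _ _ e e e, ← submatrix_mul_equiv _ _ e e e]
    simp
  · intro M hM
    rw [← fromBlocks_toBlocks M, fromBlocks_multiply, fromBlocks_multiply, fromBlocks_inj] at hM
    simp only [Matrix.zero_mul, Matrix.one_mul, Matrix.mul_zero, Matrix.mul_one, add_zero,
      zero_add] at hM
    exact ⟨eq_zero_of_eq_mul hh hM.2.1, eq_zero_of_eq_mul_right hh hM.2.2.1.symm⟩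
  · intro A D
    rw [fromBlocks_multiply, fromBlocks_multiply, fromBlocks_inj]
    simp

end Matrix

theorem stmt8 (q n : ℕ) (hq : IsPrimePow q) (hn : 1 ≤ n)
    (F : Type) [Field F] [Fintype F] (hF : Fintype.card F = q)
    (h₀ : GL (Fin (n + n)) F) (hh : (h₀.val - 1).det ≠ 0) :
    Nat.card {g : GL (Fin (n + n + 1)) F //
        ∃ c : GL (Fin (n + n + 1)) F,
          (c * (g * tau g) * c⁻¹).val =
            Matrix.reindex finSumFinEquiv finSumFinEquiv
              (Matrix.fromBlocks h₀.val 0 0 (1 : Matrix (Fin 1) (Fin 1) F))} *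
      Nat.card (Matrix.symplecticGroup (Fin n) F) =
    Nat.card {s : Matrix (Fin n ⊕ Fin n) (Fin n ⊕ Fin n) F //
        s ∈ Matrix.symplecticGroup (Fin n) F ∧
        ∃ c : GL (Fin (n + n)) F,
          Matrix.reindex finSumFinEquiv finSumFinEquiv s = c.val * h₀.val * (c⁻¹).val} *
      Nat.card (GL (Fin (n + n + 1)) F) := by
  set e : Fin (n + n) ⊕ Fin 1 ≃ Fin (n + n + 1) := finSumFinEquiv
  set e' : Fin (n + n) ≃ Fin n ⊕ Fin n := finSumFinEquiv.symm
  have hleft := card_subtype_GL fun M : Matrix (Fin (n + n + 1)) (Fin (n + n + 1)) F =>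
    ∃ c, conjBy c (M * (M⁻¹)ᵀ) = reindex e e (fromBlocks h₀.val 0 0 1)
  have htau (g : GL (Fin (n + n + 1)) F) : (g * tau g).val = g.val * (g.val⁻¹)ᵀ := by
    rw [Units.val_mul, ← coe_units_inv]; rfl
  simp only [conjBy, ← htau, ← Units.val_mul] at hleft
  have horbit := card_conj_mul_inv_transpose
    (reindex e e (fromBlocks h₀.val 0 0 (1 : Matrix (Fin 1) (Fin 1) F)))
  have hpairs := card_symplecticPair_conj_mul_card_centralizer h₀.val
  have hsymp := card_symplecticPair_conj_mul_card_symplecticGroup e' h₀.val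
  rw [card_symplecticPair_fst_eq h₀ hh] at hpairs
  rw [card_mul_inv_transpose_eq_blockDiagonal e hh, card_centralizer_blockDiagonal e hh] at horbit
  have hright : Nat.card {s : Matrix (Fin n ⊕ Fin n) (Fin n ⊕ Fin n) F //
        s ∈ Matrix.symplecticGroup (Fin n) F ∧
        ∃ c : GL (Fin (n + n)) F,
          Matrix.reindex finSumFinEquiv finSumFinEquiv s = c.val * h₀.val * (c⁻¹).val} =
      Nat.card {s : Matrix (Fin n ⊕ Fin n) (Fin n ⊕ Fin n) F //
        s ∈ symplecticGroup (Fin n) F ∧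
          ∃ c : GL (Fin (n + n)) F, conjBy c (reindex e'.symm e'.symm s) = h₀.val} := by
    refine Nat.card_congr (Equiv.subtypeEquivRight fun s => and_congr_right fun _ => ?_)
    constructor
    · rintro ⟨c, hc⟩
      exact ⟨c⁻¹, (congrArg (conjBy c⁻¹) hc).trans (by
        rw [← conjBy, ← conjBy_mul, inv_mul_cancel, conjBy_one])⟩
    · rintro ⟨c, hc⟩
      refine ⟨c⁻¹, ?_⟩
      rw [← conjBy, ← hc, ← conjBy_mul, inv_mul_cancel, conjBy_one]
      rfl
  rw [hright]
  have hD : 0 < Nat.card {D : Matrix (Fin 1) (Fin 1) F // IsUnit D.det} :=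
    Nat.card_pos_iff.2 ⟨⟨⟨1, by simp⟩⟩, inferInstance⟩
  have hC : 0 < Nat.card {c : GL (Fin (n + n)) F // conjBy c h₀.val = h₀.val} :=
    Nat.card_pos_iff.2 ⟨⟨⟨1, conjBy_one _⟩⟩, inferInstance⟩
  have hK : 0 < Nat.card (GL (Fin (n + n)) F) := Nat.card_pos
  have cancel {L C D G Y P A S T : ℕ} (hD : 0 < D) (hC : 0 < C) (hA : 0 < A)
      (h₁ : L * (C * D) = G * (Y * D)) (h₂ : P * C = A * Y) (h₃ : P * S = A * T) :
      L * S = T * G := by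
    refine Nat.eq_of_mul_eq_mul_right (Nat.mul_pos (Nat.mul_pos hC hD) hA) ?_
    zify at *
    linear_combination (S * A) * h₁ - (G * D * S) * h₂ + (G * D * C) * h₃
  rw [hleft]
  exact cancel hD hC hK horbit hpairs hsymp
end
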